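/- There is a universal constant c > 0 with the following property. Let m ≥ 2 and let G be the disjoint union of directed graphs G_1,…,G_m, where G_k is a loop-less clique on n_k ≥ 2 vertices (all directed edges between distinct vertices of G_k are present and there are no self-loops). Then there exists T₀ (depending on G) such that for every T ≥ T₀ the mini-max regret satisfies R*_G(T) ≤ c·(Σ_{k=1}^m log n_k)^{1/3}·T^{2/3}. -/

import Mathlib

open scoped BigOperators

/-- A policy maps the chronological history of (arm, feedback) pairs to a
probability distribution over arms.  The feedback after playing arm `a` is
recorded as a function `V → Option ℝ`, giving the observed loss on the
out-neighbors of `a` and `none` elsewhere. -/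
def Policy (V : Type) : Type :=
  List (V × (V → Option ℝ)) → PMF V

/-- The feedback revealed when arm `a` is played against the loss vector `ℓ`:
exactly the values `ℓ j` for out-neighbors `j` of `a`. -/
def feedbackOf {V : Type} (E : V → V → Bool) (ℓ : V → ℝ) (a : V) : V → Option ℝ :=
  fun j => if E a j then some (ℓ j) else none

/-- The chronological history produced by playing the arm sequence `as`
against the loss sequence `ℓ`. -/
def hist {V : Type} (E : V → V → Bool) (ℓ : ℕ → V → ℝ) (as : List V) :
    List (V × (V → Option ℝ)) :=
  (List.range as.length).zipWith (fun t a => (a, feedbackOf E (ℓ t) a)) as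

/-- Probability that the policy `π` plays exactly the arm sequence `as`
during the first `T` rounds. -/
noncomputable def seqProb {V : Type} [Fintype V] (π : Policy V) (E : V → V → Bool)
    (ℓ : ℕ → V → ℝ) (T : ℕ) (as : Fin T → V) : ℝ :=
  ∏ t : Fin T, (π (hist E ℓ ((List.ofFn as).take t.val)) (as t)).toReal

/-- Expected cumulative loss of the policy `π` over `T` rounds. -/
noncomputable def expectedLoss {V : Type} [Fintype V] (π : Policy V) (E : V → V → Bool)
    (ℓ : ℕ → V → ℝ) (T : ℕ) : ℝ :=
  ∑ as : Fin T → V, seqProb π E ℓ T as * ∑ t : Fin T, ℓ t.val (as t)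

/-- Regret of the policy `π` with respect to the fixed arm `a`. -/
noncomputable def regretTo {V : Type} [Fintype V] (π : Policy V) (E : V → V → Bool)
    (ℓ : ℕ → V → ℝ) (T : ℕ) (a : V) : ℝ :=
  expectedLoss π E ℓ T - ∑ t : Fin T, ℓ t.val a

/-- Regret of the policy `π` with respect to the best fixed arm. -/
noncomputable def regret {V : Type} [Fintype V] (π : Policy V) (E : V → V → Bool)
    (ℓ : ℕ → V → ℝ) (T : ℕ) : ℝ :=
  expectedLoss π E ℓ T - ⨅ a : V, ∑ t : Fin T, ℓ t.val a

/-- A loss sequence taking values in `[0,1]`. -/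
def ValidLoss {V : Type} (ℓ : ℕ → V → ℝ) : Prop :=
  ∀ t v, 0 ≤ ℓ t v ∧ ℓ t v ≤ 1

/-- The mini-max regret of the feedback graph `E` on `V` at horizon `T`. -/
noncomputable def minimaxRegret (V : Type) [Fintype V] (E : V → V → Bool) (T : ℕ) : ℝ :=
  ⨅ π : Policy V, ⨆ ℓ : {ℓ : ℕ → V → ℝ // ValidLoss ℓ}, regret π E ℓ.1 T

/-- A vertex is observable if it has an in-neighbor. -/
def ObservableVertex {V : Type} (E : V → V → Bool) (v : V) : Prop :=
  ∃ u, E u v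

/-- A vertex is strongly observable if it has a self-loop or is observed by
all other vertices. -/
def StronglyObservableVertex {V : Type} (E : V → V → Bool) (v : V) : Prop :=
  E v v ∨ ∀ u, u ≠ v → E u v

/-- A graph is observable if every vertex is observable. -/
def Observable {V : Type} (E : V → V → Bool) : Prop :=
  ∀ v, ObservableVertex E v

/-- A graph is strongly observable if every vertex is strongly observable. -/
def StronglyObservable {V : Type} (E : V → V → Bool) : Prop :=
  ∀ v, StronglyObservableVertex E v

/-- A graph is weakly observable if it is observable but not strongly
observable. -/
def WeaklyObservable {V : Type} (E : V → V → Bool) : Prop :=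
  Observable E ∧ ¬ StronglyObservable E

/-! ### Expected loss through a potential -/

lemma hist_append_singleton {V : Type} (E : V → V → Bool) (ℓ : ℕ → V → ℝ) (as : List V) (a : V) :
    hist E ℓ (as ++ [a]) = hist E ℓ as ++ [(a, feedbackOf E (ℓ as.length) a)] := by
  unfold hist
  rw [List.length_append, List.length_singleton, List.range_succ,
    List.zipWith_append (by simp)]
  simp

lemma sum_fin_succ_arrow {V : Type} [Fintype V] (T : ℕ) (f : (Fin (T + 1) → V) → ℝ) :
    ∑ as, f as = ∑ as : Fin T → V, ∑ a, f (Fin.snoc as a) := by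
  rw [← (Fin.snocEquiv (fun _ : Fin (T + 1) => V)).sum_comp, Fintype.sum_prod_type,
    Finset.sum_comm]
  rfl

lemma seqProb_snoc {V : Type} [Fintype V] (π : Policy V) (E : V → V → Bool) (ℓ : ℕ → V → ℝ)
    (T : ℕ) (as : Fin T → V) (a : V) :
    seqProb π E ℓ (T + 1) (Fin.snoc as a) =
      seqProb π E ℓ T as * (π (hist E ℓ (List.ofFn as)) a).toReal := by
  have h : List.ofFn (Fin.snoc as a : Fin (T + 1) → V) = List.ofFn as ++ [a] := by
    rw [List.ofFn_succ']
    simp [List.concat_eq_append]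
  unfold seqProb
  rw [Fin.prod_univ_castSucc, h]
  congr 1
  · refine Finset.prod_congr rfl fun t _ => ?_
    rw [Fin.snoc_castSucc, Fin.val_castSucc, List.take_append_of_le_length]
    simp
  · rw [Fin.snoc_last, Fin.val_last, List.take_append_of_le_length (by simp),
      List.take_of_length_le (by simp)]

lemma seqProb_nonneg {V : Type} [Fintype V] (π : Policy V) (E : V → V → Bool) (ℓ : ℕ → V → ℝ)
    (T : ℕ) (as : Fin T → V) : 0 ≤ seqProb π E ℓ T as :=
  Finset.prod_nonneg fun _ _ => ENNReal.toReal_nonneg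

lemma sum_toReal_pmf {V : Type} [Fintype V] (μ : PMF V) : ∑ a, (μ a).toReal = 1 := by
  have h := μ.tsum_coe
  rw [tsum_fintype] at h
  rw [← ENNReal.toReal_sum fun a _ => μ.apply_ne_top a, h, ENNReal.toReal_one]

/-- A potential that decreases in conditional expectation by the instantaneous regret, up to an
error `b` per round, controls the expected loss. -/
lemma expectedLoss_add_potential_le {V : Type} [Fintype V] (π : Policy V) (E : V → V → Bool)
    (ℓ : ℕ → V → ℝ) (Ψ : List V → ℝ) (b : ℝ) (u : ℕ → ℝ)
    (hstep : ∀ as : List V, ∑ a, (π (hist E ℓ as) a).toReal * (ℓ as.length a + Ψ (as ++ [a])) ≤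
      Ψ as + b + u as.length) (T : ℕ) :
    ∑ as : Fin T → V, seqProb π E ℓ T as * (∑ t : Fin T, ℓ t.val (as t) + Ψ (List.ofFn as)) ≤
      Ψ [] + T * b + ∑ t : Fin T, u t.val := by
  induction T with
  | zero => simp [seqProb]
  | succ T ih =>
    rw [sum_fin_succ_arrow, Fin.sum_univ_castSucc]
    have hprob : ∀ as : Fin T → V,
        ∑ a, (π (hist E ℓ (List.ofFn as)) a).toReal = 1 := fun as => sum_toReal_pmf _
    have key : ∀ as : Fin T → V,
        ∑ a, seqProb π E ℓ (T + 1) (Fin.snoc as a) *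
          (∑ t : Fin (T + 1), ℓ t.val ((Fin.snoc as a : Fin (T + 1) → V) t) +
            Ψ (List.ofFn (Fin.snoc as a : Fin (T + 1) → V))) ≤
        seqProb π E ℓ T as * (∑ t : Fin T, ℓ t.val (as t) + Ψ (List.ofFn as)) +
          seqProb π E ℓ T as * (b + u T) := by
      intro as
      have h := hstep (List.ofFn as)
      rw [List.length_ofFn] at h
      have e : ∀ a, seqProb π E ℓ (T + 1) (Fin.snoc as a) *
          (∑ t : Fin (T + 1), ℓ t.val ((Fin.snoc as a : Fin (T + 1) → V) t) +
            Ψ (List.ofFn (Fin.snoc as a : Fin (T + 1) → V))) =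
          seqProb π E ℓ T as * ((π (hist E ℓ (List.ofFn as)) a).toReal *
            (∑ t : Fin T, ℓ t.val (as t)) + (π (hist E ℓ (List.ofFn as)) a).toReal *
              (ℓ T a + Ψ (List.ofFn as ++ [a]))) := by
        intro a
        rw [seqProb_snoc, Fin.sum_univ_castSucc, List.ofFn_succ']
        simp only [Fin.snoc_castSucc, Fin.snoc_last, Fin.val_castSucc, Fin.val_last,
          List.concat_eq_append]
        ring
      rw [Finset.sum_congr rfl fun a _ => e a, ← Finset.mul_sum, Finset.sum_add_distrib,
        ← Finset.sum_mul, hprob, ← mul_add]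
      exact mul_le_mul_of_nonneg_left (by linarith) (seqProb_nonneg _ _ _ _ _)
    have hone : ∑ as : Fin T → V, seqProb π E ℓ T as = 1 := by
      clear ih key hprob
      induction T with
      | zero => simp [seqProb]
      | succ T ih =>
        rw [sum_fin_succ_arrow, ← ih]
        refine Finset.sum_congr rfl fun as _ => ?_
        simp_rw [seqProb_snoc]
        rw [← Finset.mul_sum, sum_toReal_pmf, mul_one]
    refine (Finset.sum_le_sum fun as _ => key as).trans ?_
    rw [Finset.sum_add_distrib, ← Finset.sum_mul, hone]
    push_cast
    simp only [Fin.val_castSucc]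
    linarith

lemma regret_le_of_potential {V : Type} [Fintype V] [Nonempty V] (π : Policy V)
    (E : V → V → Bool) (ℓ : ℕ → V → ℝ) (Ψ : V → List V → ℝ) (b B : ℝ) (T : ℕ)
    (hnonneg : ∀ v as, 0 ≤ Ψ v as)
    (hstep : ∀ v as, ∑ a, (π (hist E ℓ as) a).toReal * (ℓ as.length a + Ψ v (as ++ [a])) ≤
      Ψ v as + b + ℓ as.length v)
    (hstart : ∀ v, Ψ v [] + T * b ≤ B) :
    regret π E ℓ T ≤ B := by
  have h : ∀ v, expectedLoss π E ℓ T - B ≤ ∑ t : Fin T, ℓ t.val v := by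
    intro v
    have h₁ := expectedLoss_add_potential_le π E ℓ (Ψ v) b (fun t => ℓ t v) (hstep v) T
    have h₂ : expectedLoss π E ℓ T ≤ ∑ as : Fin T → V,
        seqProb π E ℓ T as * (∑ t : Fin T, ℓ t.val (as t) + Ψ v (List.ofFn as)) :=
      Finset.sum_le_sum fun as _ => mul_le_mul_of_nonneg_left
        (le_add_of_nonneg_right (hnonneg _ _)) (seqProb_nonneg _ _ _ _ _)
    linarith [hstart v]
  have := le_ciInf h
  unfold regret
  linarith

lemma minimaxRegret_le_of_policy {V : Type} [Fintype V] (E : V → V → Bool) (T : ℕ)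
    (π : Policy V) (B : ℝ) (hB : 0 ≤ B)
    (h : ∀ ℓ, ValidLoss ℓ → regret π E ℓ T ≤ B) : minimaxRegret V E T ≤ B := by
  have hsup : ⨆ ℓ : {ℓ : ℕ → V → ℝ // ValidLoss ℓ}, regret π E ℓ.1 T ≤ B :=
    Real.iSup_le (fun ℓ => h ℓ.1 ℓ.2) hB
  unfold minimaxRegret
  by_cases hb : BddBelow (Set.range fun π : Policy V =>
      ⨆ ℓ : {ℓ : ℕ → V → ℝ // ValidLoss ℓ}, regret π E ℓ.1 T)
  · exact (ciInf_le hb π).trans hsup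
  · rw [Real.iInf_of_not_bddBelow hb]
    exact hB

/-! ### Regularised leader with the square-root (Tsallis) regulariser -/

lemma exists_tsallisRoot {K : Type*} [Fintype K] [Nonempty K] (z : K → ℝ) :
    ∃ r : K → ℝ, (∀ k, 0 < r k) ∧ ∑ k, r k ^ 2 = 1 ∧ ∃ c, ∀ k, r k * (z k - c) = 1 := by
  obtain ⟨k₀, hk₀⟩ := Finite.exists_min z
  have hcard : (1 : ℝ) ≤ Fintype.card K := by exact_mod_cast Fintype.card_pos
  set d := √(Fintype.card K : ℝ) with hd
  have hd1 : 1 ≤ d := Real.one_le_sqrt.2 hcard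
  have hpos : ∀ c ∈ Set.Icc (z k₀ - d) (z k₀ - 1), ∀ k, 0 < z k - c := by
    intro c hc k
    linarith [hc.2, hk₀ k]
  have hcont : ContinuousOn (fun c => ∑ k, ((z k - c)⁻¹) ^ 2) (Set.Icc (z k₀ - d) (z k₀ - 1)) := by
    refine continuousOn_finsetSum _ fun k _ => ContinuousOn.pow (ContinuousOn.inv₀ ?_ ?_) 2
    · fun_prop
    · exact fun c hc => (hpos c hc k).ne'
  have hmem : (1 : ℝ) ∈ Set.Icc (∑ k, ((z k - (z k₀ - d))⁻¹) ^ 2)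
      (∑ k, ((z k - (z k₀ - 1))⁻¹) ^ 2) := by
    constructor
    · have : ∀ k ∈ Finset.univ, ((z k - (z k₀ - d))⁻¹) ^ 2 ≤ (d⁻¹) ^ 2 := by
        intro k _
        have := hk₀ k
        have h₀ : 0 < d := by linarith
        gcongr
        · exact inv_nonneg.2 (by linarith)
        · linarith
      refine (Finset.sum_le_sum this).trans ?_
      rw [Finset.sum_const, nsmul_eq_mul, inv_pow, hd, Real.sq_sqrt (by linarith),
        Finset.card_univ, mul_inv_cancel₀ (by linarith)]
    · refine le_trans ?_ (Finset.single_le_sum (f := fun k => ((z k - (z k₀ - 1))⁻¹) ^ 2)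
        (fun k _ => sq_nonneg _) (Finset.mem_univ k₀))
      simp
  obtain ⟨c, hc, hsum⟩ := intermediate_value_Icc (by linarith) hcont hmem
  exact ⟨fun k => (z k - c)⁻¹, fun k => inv_pos.2 (hpos c hc k), hsum, c,
    fun k => inv_mul_cancel₀ (hpos c hc k).ne'⟩

/-- Coordinatewise square root of the minimiser of `⟨x, z⟩ - 2 ∑ √x` over the simplex. -/
noncomputable def tsallisRoot {K : Type*} [Fintype K] [Nonempty K] (z : K → ℝ) : K → ℝ :=
  (exists_tsallisRoot z).choose

/-- Minimal value of `⟨x, z⟩ - 2 ∑ √x` over the simplex. -/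
noncomputable def tsallisValue {K : Type*} [Fintype K] [Nonempty K] (z : K → ℝ) : ℝ :=
  ∑ k, (tsallisRoot z k ^ 2 * z k - 2 * tsallisRoot z k)

section Tsallis

variable {K : Type*} [Fintype K] [Nonempty K] (z : K → ℝ)

lemma tsallisRoot_pos (k : K) : 0 < tsallisRoot z k :=
  (exists_tsallisRoot z).choose_spec.1 k

lemma sum_tsallisRoot_sq : ∑ k, tsallisRoot z k ^ 2 = 1 :=
  (exists_tsallisRoot z).choose_spec.2.1

lemma sum_tsallisRoot_le : ∑ k, tsallisRoot z k ≤ √(Fintype.card K : ℝ) := by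
  refine Real.le_sqrt_of_sq_le ?_
  have := sq_sum_le_card_mul_sum_sq (s := Finset.univ) (f := tsallisRoot z)
  rwa [sum_tsallisRoot_sq, mul_one, Finset.card_univ] at this

/-- The objective exceeds its minimum by the Bregman divergence from the minimiser. -/
lemma tsallisValue_add_bregman (y : K → ℝ) (hy : ∑ k, y k ^ 2 = 1) :
    ∑ k, (y k ^ 2 * z k - 2 * y k) =
      tsallisValue z + ∑ k, (y k - tsallisRoot z k) ^ 2 / tsallisRoot z k := by
  obtain ⟨c, hc⟩ := (exists_tsallisRoot z).choose_spec.2.2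
  change ∀ k, tsallisRoot z k * (z k - c) = 1 at hc
  have hr := sum_tsallisRoot_sq z
  have hz : ∀ k, z k = (tsallisRoot z k)⁻¹ + c := fun k => by
    rw [← eq_inv_of_mul_eq_one_right (hc k), sub_add_cancel]
  have h : ∀ k, y k ^ 2 * z k - 2 * y k =
      (tsallisRoot z k ^ 2 * z k - 2 * tsallisRoot z k) +
        (y k - tsallisRoot z k) ^ 2 / tsallisRoot z k +
        (c * y k ^ 2 - c * tsallisRoot z k ^ 2) := fun k => by
    have := (tsallisRoot_pos z k).ne'
    have hzk := hz k
    generalize tsallisRoot z k = r at *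
    rw [hzk]
    field_simp
    ring
  rw [Finset.sum_congr rfl fun k _ => h k, Finset.sum_add_distrib, Finset.sum_add_distrib,
    Finset.sum_sub_distrib (fun k => c * y k ^ 2), ← Finset.mul_sum, ← Finset.mul_sum, hr, hy,
    sub_self, add_zero, tsallisValue]

lemma tsallisValue_le (k : K) : tsallisValue z ≤ z k := by
  classical
  have h := tsallisValue_add_bregman z (Pi.single k 1) (by
    simp [Pi.single_apply, ite_pow])
  have h₁ : 0 ≤ ∑ j, ((Pi.single k 1 : K → ℝ) j - tsallisRoot z j) ^ 2 / tsallisRoot z j :=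
    Finset.sum_nonneg fun j _ => div_nonneg (sq_nonneg _) (tsallisRoot_pos z j).le
  have h₂ : ∑ j, ((Pi.single k 1 : K → ℝ) j ^ 2 * z j - 2 * (Pi.single k 1 : K → ℝ) j) =
      z k - 2 := by
    simp [Pi.single_apply, ite_pow, Finset.sum_sub_distrib]
  linarith

lemma neg_tsallisValue_zero_le :
    -tsallisValue (0 : K → ℝ) ≤ 2 * √(Fintype.card K : ℝ) := by
  have := sum_tsallisRoot_le (0 : K → ℝ)
  simp only [tsallisValue, Pi.zero_apply, mul_zero, zero_sub, Finset.sum_neg_distrib, neg_neg,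
    ← Finset.mul_sum]
  linarith

lemma tsallisValue_add_ge (d : K → ℝ) (hd : ∀ k, 0 ≤ d k) :
    tsallisValue z + ∑ k, tsallisRoot z k ^ 2 * d k - ∑ k, tsallisRoot z k ^ 3 * d k ^ 2 ≤
      tsallisValue (fun k => z k + d k) := by
  set y := tsallisRoot (fun k => z k + d k) with hy
  have h := tsallisValue_add_bregman z y (sum_tsallisRoot_sq _)
  have e : tsallisValue (fun k => z k + d k) =
      ∑ k, (y k ^ 2 * z k - 2 * y k) + ∑ k, y k ^ 2 * d k := by
    rw [tsallisValue, ← Finset.sum_add_distrib]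
    exact Finset.sum_congr rfl fun k _ => by rw [← hy]; ring
  rw [e, h, add_sub_assoc, add_assoc, add_le_add_iff_left, ← Finset.sum_sub_distrib,
    ← Finset.sum_add_distrib]
  refine Finset.sum_le_sum fun k _ => ?_
  have hr := tsallisRoot_pos z k
  generalize tsallisRoot z k = r at *
  have : (y k - r) ^ 2 / r + y k ^ 2 * d k - (r ^ 2 * d k - r ^ 3 * d k ^ 2) =
      (r - y k - r ^ 2 * d k) ^ 2 / r + (r - y k) ^ 2 * d k := by
    field_simp
    ring
  have h₁ : 0 ≤ (r - y k - r ^ 2 * d k) ^ 2 / r := by positivity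
  have h₂ : 0 ≤ (r - y k) ^ 2 * d k := mul_nonneg (sq_nonneg _) (hd k)
  linarith

end Tsallis

/-! ### Exponential weights -/

/-- The exponential-weights distribution for cumulative losses `z`. -/
noncomputable def hedge {I : Type*} [Fintype I] (z : I → ℝ) (i : I) : ℝ :=
  Real.exp (-z i) / ∑ j, Real.exp (-z j)

lemma hedge_nonneg {I : Type*} [Fintype I] (z : I → ℝ) (i : I) : 0 ≤ hedge z i :=
  div_nonneg (Real.exp_pos _).le (Finset.sum_nonneg fun _ _ => (Real.exp_pos _).le)

lemma sum_exp_neg_pos {I : Type*} [Fintype I] [Nonempty I] (z : I → ℝ) :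
    0 < ∑ j, Real.exp (-z j) :=
  Finset.sum_pos (fun _ _ => Real.exp_pos _) Finset.univ_nonempty

lemma sum_hedge {I : Type*} [Fintype I] [Nonempty I] (z : I → ℝ) : ∑ i, hedge z i = 1 := by
  simp only [hedge]
  rw [← Finset.sum_div, div_self (sum_exp_neg_pos z).ne']

lemma exp_neg_le_one_sub_add_sq {d : ℝ} (hd : 0 ≤ d) : Real.exp (-d) ≤ 1 - d + d ^ 2 := by
  rcases le_total d 1 with h | h
  · have := Real.abs_exp_sub_one_sub_id_le (x := -d) (by rwa [abs_neg, abs_of_nonneg hd])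
    have := (abs_le.1 this).2
    linarith [neg_sq d]
  · have : Real.exp (-d) ≤ 1 := Real.exp_le_one_iff.2 (by linarith)
    nlinarith

lemma log_sum_exp_neg_add_le {I : Type*} [Fintype I] [Nonempty I] (z d : I → ℝ)
    (hd : ∀ i, 0 ≤ d i) :
    Real.log (∑ i, Real.exp (-(z i + d i))) ≤
      Real.log (∑ i, Real.exp (-z i)) - ∑ i, hedge z i * d i + ∑ i, hedge z i * d i ^ 2 := by
  have hZ := sum_exp_neg_pos z
  have h₁ : (∑ i, Real.exp (-(z i + d i))) / ∑ i, Real.exp (-z i) ≤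
      1 - ∑ i, hedge z i * d i + ∑ i, hedge z i * d i ^ 2 := by
    rw [← sum_hedge z, ← Finset.sum_sub_distrib, ← Finset.sum_add_distrib, Finset.sum_div]
    refine Finset.sum_le_sum fun i _ => ?_
    have e : Real.exp (-(z i + d i)) / ∑ i, Real.exp (-z i) = hedge z i * Real.exp (-d i) := by
      rw [hedge, neg_add, Real.exp_add]
      ring
    rw [e]
    have := mul_le_mul_of_nonneg_left (exp_neg_le_one_sub_add_sq (hd i)) (hedge_nonneg z i)
    linarith
  have h₂ := Real.log_le_sub_one_of_pos
    (div_pos (sum_exp_neg_pos fun i => z i + d i) hZ)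
  rw [Real.log_div (sum_exp_neg_pos fun i => z i + d i).ne' hZ.ne'] at h₂
  linarith

lemma neg_le_log_sum_exp_neg {I : Type*} [Fintype I] (z : I → ℝ) (i : I) :
    -z i ≤ Real.log (∑ j, Real.exp (-z j)) := by
  rw [← Real.log_exp (-z i)]
  refine Real.log_le_log (Real.exp_pos _) ?_
  exact Finset.single_le_sum (f := fun j => Real.exp (-z j)) (fun _ _ => (Real.exp_pos _).le)
    (Finset.mem_univ i)

/-! ### The two-level algorithm -/

/-- Parameters of the two-level algorithm on a vertex set partitioned into blocks indexed by `K`: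
the exploration rate, the learning rates of the algorithm choosing a block and of the algorithms
inside the blocks, and the distribution of the uniform part of the exploration over blocks. -/
structure BlockParams (K : Type) where
  explore : ℝ
  outerRate : ℝ
  innerRate : K → ℝ
  weight : K → ℝ

/-- Cumulative estimated losses of the vertices and of the blocks. -/
abbrev BlockState (K : Type) (I : K → Type) : Type :=
  ((Σ k, I k) → ℝ) × (K → ℝ)

namespace BlockParams

variable {K : Type} {I : K → Type} (P : BlockParams K)
  (E : (Σ k, I k) → (Σ k, I k) → Bool) (s : BlockState K I)

section Inner

variable [∀ k, Fintype (I k)]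

/-- Distribution inside block `k`. -/
noncomputable def inner (k : K) : I k → ℝ :=
  hedge fun i => P.innerRate k * s.1 ⟨k, i⟩

lemma inner_nonneg (k : K) (i : I k) : 0 ≤ P.inner s k i := hedge_nonneg _ i

lemma sum_inner [∀ k, Nonempty (I k)] (k : K) : ∑ i, P.inner s k i = 1 := sum_hedge _

end Inner

section Root

variable [Fintype K] [Nonempty K]

/-- Square root of the probability of each block. -/
noncomputable def root : K → ℝ :=
  tsallisRoot fun k => P.outerRate * s.2 k

lemma root_pos (k : K) : 0 < P.root s k := tsallisRoot_pos _ k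

lemma sum_root_sq : ∑ k, P.root s k ^ 2 = 1 := sum_tsallisRoot_sq _

end Root

variable [Fintype K] [Nonempty K] [∀ k, Fintype (I k)]

/-- Exploitation probability of a vertex. -/
noncomputable def exploit (v : Σ k, I k) : ℝ :=
  P.root s v.1 ^ 2 * P.inner s v.1 v.2

/-- Probability of playing a vertex. -/
noncomputable def play (v : Σ k, I k) : ℝ :=
  (1 - P.explore) * P.exploit s v +
    P.explore * ((P.weight v.1 + P.root s v.1 ^ 2) / 2 / Fintype.card (I v.1))

/-- Probability of observing a vertex. -/
noncomputable def observe (v : Σ k, I k) : ℝ :=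
  ∑ a, if E a v then P.play s a else 0

/-- Importance-weighted estimate of the losses. -/
noncomputable def estimate (f : (Σ k, I k) → Option ℝ) (v : Σ k, I k) : ℝ :=
  (f v).getD 0 / P.observe E s v

/-- The state after losses estimated by `l`. -/
noncomputable def next (l : (Σ k, I k) → ℝ) : BlockState K I :=
  (fun v => s.1 v + l v, fun k => s.2 k + ∑ i, P.inner s k i * l ⟨k, i⟩)

/-- The potential comparing the algorithm in state `s` with the fixed vertex `v`. -/
noncomputable def potential (v : Σ k, I k) : ℝ :=
  (s.2 v.1 - tsallisValue (fun k => P.outerRate * s.2 k) / P.outerRate) +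
    (Real.log (∑ i, Real.exp (-(P.innerRate v.1 * s.1 ⟨v.1, i⟩))) / P.innerRate v.1 + s.1 v)

/-- The state reached after a history. -/
noncomputable def state (h : List ((Σ k, I k) × ((Σ k, I k) → Option ℝ))) : BlockState K I :=
  h.foldl (fun s x => P.next s (P.estimate E s x.2)) (0, 0)

/-- Positivity and normalisation of the parameters. -/
structure Valid : Prop where
  explore_pos : 0 < P.explore
  explore_le_one : P.explore ≤ 1
  outerRate_pos : 0 < P.outerRate
  innerRate_pos : ∀ k, 0 < P.innerRate k
  weight_pos : ∀ k, 0 < P.weight k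
  sum_weight : ∑ k, P.weight k = 1

lemma exploit_nonneg (v : Σ k, I k) : 0 ≤ P.exploit s v :=
  mul_nonneg (sq_nonneg _) (P.inner_nonneg s _ _)

lemma sum_exploit_eq (f : (Σ k, I k) → ℝ) :
    ∑ v, P.exploit s v * f v = ∑ k, P.root s k ^ 2 * ∑ i, P.inner s k i * f ⟨k, i⟩ := by
  simp only [Fintype.sum_sigma, exploit, Finset.mul_sum, mul_assoc]

lemma sum_exploit [∀ k, Nonempty (I k)] : ∑ v, P.exploit s v = 1 := by
  have := P.sum_exploit_eq s (fun _ => 1)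
  simpa [sum_inner, sum_root_sq] using this

variable {P}

lemma Valid.exploration_nonneg (hP : P.Valid) (v : Σ k, I k) :
    0 ≤ (P.weight v.1 + P.root s v.1 ^ 2) / 2 / Fintype.card (I v.1) := by
  have := hP.weight_pos v.1
  positivity

lemma Valid.sum_exploration [∀ k, Nonempty (I k)] (hP : P.Valid) :
    ∑ v : Σ k, I k, (P.weight v.1 + P.root s v.1 ^ 2) / 2 / Fintype.card (I v.1) = 1 := by
  rw [Fintype.sum_sigma]
  have h : ∀ k, ∑ _i : I k, (P.weight k + P.root s k ^ 2) / 2 / Fintype.card (I k) =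
      (P.weight k + P.root s k ^ 2) / 2 := fun k => by
    rw [Finset.sum_const, nsmul_eq_mul, Finset.card_univ, mul_div_cancel₀]
    exact_mod_cast Fintype.card_ne_zero
  rw [Finset.sum_congr rfl fun k _ => h k, ← Finset.sum_div, Finset.sum_add_distrib,
    hP.sum_weight, sum_root_sq]
  norm_num

lemma Valid.explore_mul_le_play (hP : P.Valid) (v : Σ k, I k) :
    P.explore * ((P.weight v.1 + P.root s v.1 ^ 2) / 2 / Fintype.card (I v.1)) ≤ P.play s v :=
  le_add_of_nonneg_left (mul_nonneg (by linarith [hP.explore_le_one]) (P.exploit_nonneg s v))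

lemma Valid.play_nonneg (hP : P.Valid) (v : Σ k, I k) : 0 ≤ P.play s v :=
  (mul_nonneg hP.explore_pos.le (hP.exploration_nonneg s v)).trans (hP.explore_mul_le_play s v)

lemma Valid.sum_play [∀ k, Nonempty (I k)] (hP : P.Valid) : ∑ v, P.play s v = 1 := by
  simp only [play]
  rw [Finset.sum_add_distrib, ← Finset.mul_sum, ← Finset.mul_sum, sum_exploit,
    hP.sum_exploration]
  ring

lemma Valid.sum_play_mul_le [∀ k, Nonempty (I k)] (hP : P.Valid) (ℓ : (Σ k, I k) → ℝ)
    (hℓ : ∀ v, 0 ≤ ℓ v ∧ ℓ v ≤ 1) :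
    ∑ v, P.play s v * ℓ v ≤ ∑ v, P.exploit s v * ℓ v + P.explore := by
  have h : ∀ v ∈ Finset.univ, P.play s v * ℓ v ≤ P.exploit s v * ℓ v +
      P.explore * ((P.weight v.1 + P.root s v.1 ^ 2) / 2 / Fintype.card (I v.1)) := by
    intro v _
    have h₁ := mul_nonneg hP.explore_pos.le (hP.exploration_nonneg s v)
    have h₂ := mul_le_of_le_one_right h₁ (hℓ v).2
    have h₃ := mul_nonneg hP.explore_pos.le (mul_nonneg (P.exploit_nonneg s v) (hℓ v).1)
    unfold play
    linarith
  refine (Finset.sum_le_sum h).trans ?_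
  rw [Finset.sum_add_distrib, ← Finset.mul_sum, hP.sum_exploration, mul_one]

lemma Valid.potential_nonneg (hP : P.Valid) (v : Σ k, I k) : 0 ≤ P.potential s v := by
  have h₁ : tsallisValue (fun k => P.outerRate * s.2 k) / P.outerRate ≤ s.2 v.1 := by
    rw [div_le_iff₀' hP.outerRate_pos]
    exact tsallisValue_le _ v.1
  have h₂ : -s.1 v ≤
      Real.log (∑ i, Real.exp (-(P.innerRate v.1 * s.1 ⟨v.1, i⟩))) / P.innerRate v.1 := by
    rw [le_div_iff₀' (hP.innerRate_pos _), mul_neg]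
    exact neg_le_log_sum_exp_neg (fun i => P.innerRate v.1 * s.1 ⟨v.1, i⟩) v.2
  unfold potential
  linarith

lemma Valid.potential_zero_le (hP : P.Valid) (v : Σ k, I k) :
    P.potential (0 : BlockState K I) v ≤ 2 * √(Fintype.card K : ℝ) / P.outerRate +
      Real.log (Fintype.card (I v.1)) / P.innerRate v.1 := by
  have h := div_le_div_of_nonneg_right (neg_tsallisValue_zero_le (K := K)) hP.outerRate_pos.le
  rw [neg_div] at h
  have e : (fun _ => 0 : K → ℝ) = 0 := rfl
  simp only [potential, Prod.fst_zero, Prod.snd_zero, Pi.zero_apply, mul_zero, neg_zero,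
    Real.exp_zero, Finset.sum_const, Finset.card_univ, nsmul_eq_mul, mul_one, add_zero, e]
  linarith

lemma Valid.potential_next_le [∀ k, Nonempty (I k)] (hP : P.Valid) (l : (Σ k, I k) → ℝ) (hl : ∀ v, 0 ≤ l v)
    (v : Σ k, I k) :
    P.potential (P.next s l) v ≤ P.potential s v + l v - ∑ w, P.exploit s w * l w +
      P.outerRate * ∑ w, (P.root s w.1 * P.exploit s w) * l w ^ 2 +
      P.innerRate v.1 * ∑ i, P.inner s v.1 i * l ⟨v.1, i⟩ ^ 2 := by
  have hη := hP.outerRate_pos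
  have hε := hP.innerRate_pos v.1
  set c : K → ℝ := fun k => ∑ i, P.inner s k i * l ⟨k, i⟩ with hc
  have hc0 : ∀ k, 0 ≤ c k := fun k =>
    Finset.sum_nonneg fun i _ => mul_nonneg (P.inner_nonneg s k i) (hl _)
  have hout := tsallisValue_add_ge (fun k => P.outerRate * s.2 k) (fun k => P.outerRate * c k)
    fun k => mul_nonneg hη.le (hc0 k)
  have hin := log_sum_exp_neg_add_le (fun i => P.innerRate v.1 * s.1 ⟨v.1, i⟩)
    (fun i => P.innerRate v.1 * l ⟨v.1, i⟩) fun i => mul_nonneg hε.le (hl _)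
  change tsallisValue (fun k => P.outerRate * s.2 k) + ∑ k, P.root s k ^ 2 * _ -
    ∑ k, P.root s k ^ 3 * _ ≤ _ at hout
  change _ ≤ _ - ∑ i, P.inner s v.1 i * _ + ∑ i, P.inner s v.1 i * _ at hin
  have e₁ : ∑ k, P.root s k ^ 2 * (P.outerRate * c k) =
      P.outerRate * ∑ w, P.exploit s w * l w := by
    rw [sum_exploit_eq, Finset.mul_sum]
    exact Finset.sum_congr rfl fun k _ => by rw [hc]; ring
  have e₂ : ∑ k, P.root s k ^ 3 * (P.outerRate * c k) ^ 2 ≤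
      P.outerRate * (P.outerRate * ∑ w, (P.root s w.1 * P.exploit s w) * l w ^ 2) := by
    have e : ∑ w, (P.root s w.1 * P.exploit s w) * l w ^ 2 =
        ∑ k, P.root s k ^ 3 * ∑ i, P.inner s k i * l ⟨k, i⟩ ^ 2 := by
      have := P.sum_exploit_eq s fun w => P.root s w.1 * l w ^ 2
      rw [← Finset.sum_congr rfl fun w _ => show P.exploit s w * (P.root s w.1 * l w ^ 2) =
        (P.root s w.1 * P.exploit s w) * l w ^ 2 by ring, this]
      refine Finset.sum_congr rfl fun k _ => ?_
      simp only [Finset.mul_sum]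
      exact Finset.sum_congr rfl fun i _ => by ring
    rw [e, Finset.mul_sum, Finset.mul_sum]
    refine Finset.sum_le_sum fun k _ => ?_
    have hj : c k ^ 2 ≤ ∑ i, P.inner s k i * l ⟨k, i⟩ ^ 2 :=
      Real.pow_arith_mean_le_arith_mean_pow _ _ _ (fun i _ => P.inner_nonneg s k i)
        (P.sum_inner s k) (fun i _ => hl _) 2
    have hr := P.root_pos s k
    have : 0 ≤ P.root s k ^ 3 * P.outerRate ^ 2 := by positivity
    have := mul_le_mul_of_nonneg_left hj this
    linarith
  have e₃ : ∑ i, P.inner s v.1 i * (P.innerRate v.1 * l ⟨v.1, i⟩) = P.innerRate v.1 * c v.1 := by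
    rw [hc, Finset.mul_sum]
    exact Finset.sum_congr rfl fun i _ => by ring
  have e₄ : ∑ i, P.inner s v.1 i * (P.innerRate v.1 * l ⟨v.1, i⟩) ^ 2 =
      P.innerRate v.1 * (P.innerRate v.1 * ∑ i, P.inner s v.1 i * l ⟨v.1, i⟩ ^ 2) := by
    rw [Finset.mul_sum, Finset.mul_sum]
    exact Finset.sum_congr rfl fun i _ => by ring
  rw [e₁] at hout
  rw [e₃, e₄] at hin
  have hout' : tsallisValue (fun k => P.outerRate * s.2 k) / P.outerRate +
      ∑ w, P.exploit s w * l w -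
        P.outerRate * ∑ w, (P.root s w.1 * P.exploit s w) * l w ^ 2 ≤
      tsallisValue (fun k => P.outerRate * s.2 k + P.outerRate * c k) / P.outerRate := by
    rw [le_div_iff₀' hη, mul_sub, mul_add, mul_div_cancel₀ _ hη.ne']
    linarith
  have hin' : Real.log (∑ i, Real.exp
        (-(P.innerRate v.1 * s.1 ⟨v.1, i⟩ + P.innerRate v.1 * l ⟨v.1, i⟩))) / P.innerRate v.1 ≤
      Real.log (∑ i, Real.exp (-(P.innerRate v.1 * s.1 ⟨v.1, i⟩))) / P.innerRate v.1 - c v.1 +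
        P.innerRate v.1 * ∑ i, P.inner s v.1 i * l ⟨v.1, i⟩ ^ 2 := by
    rw [div_le_iff₀' hε, mul_add, mul_sub, mul_div_cancel₀ _ hε.ne']
    linarith
  simp only [potential, next, mul_add]
  linarith

variable {E}

/-- Every vertex is observed with probability proportional to the exploration of its block. -/
def WellObserved (P : BlockParams K) (E : (Σ k, I k) → (Σ k, I k) → Bool) : Prop :=
  ∀ (s : BlockState K I) (v : Σ k, I k),
    P.explore * (P.weight v.1 + P.root s v.1 ^ 2) / 4 ≤ P.observe E s v

lemma estimate_feedbackOf (ℓ : (Σ k, I k) → ℝ) (a v : Σ k, I k) :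
    P.estimate E s (feedbackOf E ℓ a) v = (if E a v then 1 else 0) * (ℓ v / P.observe E s v) := by
  unfold estimate feedbackOf
  split_ifs <;> simp

lemma Valid.observe_pos (hP : P.Valid) (hE : P.WellObserved E) (v : Σ k, I k) :
    0 < P.observe E s v := by
  refine lt_of_lt_of_le ?_ (hE s v)
  have := hP.weight_pos v.1
  have := hP.explore_pos
  positivity

lemma Valid.estimate_nonneg (hP : P.Valid) (hE : P.WellObserved E) (ℓ : (Σ k, I k) → ℝ)
    (hℓ : ∀ v, 0 ≤ ℓ v) (a v : Σ k, I k) : 0 ≤ P.estimate E s (feedbackOf E ℓ a) v := by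
  rw [estimate_feedbackOf]
  have := hP.observe_pos s hE v
  have := hℓ v
  split_ifs <;> positivity

lemma sum_play_mul_ite (v : Σ k, I k) (x : ℝ) :
    ∑ a, P.play s a * ((if E a v then 1 else 0) * x) = P.observe E s v * x := by
  rw [observe, Finset.sum_mul]
  exact Finset.sum_congr rfl fun a _ => by split_ifs <;> ring

lemma Valid.sum_play_mul_estimate (hP : P.Valid) (hE : P.WellObserved E) (ℓ : (Σ k, I k) → ℝ)
    (v : Σ k, I k) : ∑ a, P.play s a * P.estimate E s (feedbackOf E ℓ a) v = ℓ v := by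
  simp only [estimate_feedbackOf, sum_play_mul_ite]
  exact mul_div_cancel₀ _ (hP.observe_pos s hE v).ne'

lemma Valid.sum_play_mul_estimate_sq_le (hP : P.Valid) (hE : P.WellObserved E)
    (ℓ : (Σ k, I k) → ℝ) (hℓ : ∀ v, 0 ≤ ℓ v ∧ ℓ v ≤ 1) (v : Σ k, I k) :
    ∑ a, P.play s a * P.estimate E s (feedbackOf E ℓ a) v ^ 2 ≤
      4 / (P.explore * (P.weight v.1 + P.root s v.1 ^ 2)) := by
  have ho := hP.observe_pos s hE v
  have hγ := hP.explore_pos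
  have hw := hP.weight_pos v.1
  have e : ∀ a, P.estimate E s (feedbackOf E ℓ a) v ^ 2 =
      (if E a v then 1 else 0) * (ℓ v / P.observe E s v) ^ 2 := fun a => by
    rw [estimate_feedbackOf]
    split_ifs <;> simp
  simp only [e, sum_play_mul_ite]
  have h₁ : P.observe E s v * (ℓ v / P.observe E s v) ^ 2 = ℓ v ^ 2 / P.observe E s v := by
    field_simp
  have h₂ : ℓ v ^ 2 ≤ 1 := pow_le_one₀ (hℓ v).1 (hℓ v).2
  have h₃ := hE s v
  rw [h₁, div_le_div_iff₀ ho (by positivity)]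
  have : 0 < P.explore * (P.weight v.1 + P.root s v.1 ^ 2) := by positivity
  nlinarith

lemma sum_play_mul_sum {J : Type} [Fintype J] (c : J → ℝ) (f : (Σ k, I k) → J → ℝ) :
    ∑ a, P.play s a * ∑ j, c j * f a j = ∑ j, c j * ∑ a, P.play s a * f a j := by
  simp only [Finset.mul_sum]
  rw [Finset.sum_comm]
  exact Finset.sum_congr rfl fun j _ => Finset.sum_congr rfl fun a _ => by ring

lemma Valid.sum_play_mul_potential_le [∀ k, Nonempty (I k)] (hP : P.Valid) (hE : P.WellObserved E)
    (ℓ : (Σ k, I k) → ℝ) (hℓ : ∀ v, 0 ≤ ℓ v ∧ ℓ v ≤ 1) (ρ : ℝ)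
    (hρ : ∀ k, P.innerRate k ≤ ρ * P.weight k) (v : Σ k, I k) :
    ∑ a, P.play s a *
        (ℓ a + P.potential (P.next s (P.estimate E s (feedbackOf E ℓ a))) v) ≤
      P.potential s v + (P.explore + 4 * P.outerRate * √(Fintype.card K : ℝ) / P.explore +
        4 * ρ / P.explore) + ℓ v := by
  have hγ := hP.explore_pos
  have hη := hP.outerRate_pos
  set l := fun a => P.estimate E s (feedbackOf E ℓ a) with hl
  have h₁ : ∀ a ∈ Finset.univ, P.play s a * (ℓ a + P.potential (P.next s (l a)) v) ≤
      P.play s a * ℓ a + P.play s a * P.potential s v + P.play s a * l a v -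
        P.play s a * ∑ w, P.exploit s w * l a w +
        P.outerRate * (P.play s a * ∑ w, (P.root s w.1 * P.exploit s w) * l a w ^ 2) +
        P.innerRate v.1 * (P.play s a * ∑ i, P.inner s v.1 i * l a ⟨v.1, i⟩ ^ 2) := by
    intro a _
    have := mul_le_mul_of_nonneg_left (hP.potential_next_le s (l a)
      (hP.estimate_nonneg s hE ℓ (fun w => (hℓ w).1) a) v) (hP.play_nonneg s a)
    linarith
  refine (Finset.sum_le_sum h₁).trans ?_
  simp only [Finset.sum_add_distrib, Finset.sum_sub_distrib]
  rw [← Finset.mul_sum, ← Finset.mul_sum, ← Finset.sum_mul, hP.sum_play, one_mul,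
    sum_play_mul_sum, sum_play_mul_sum s (fun w => P.root s w.1 * P.exploit s w)
      (fun a w => l a w ^ 2),
    sum_play_mul_sum s (P.inner s v.1) (fun a i => l a ⟨v.1, i⟩ ^ 2)]
  simp only [hl, hP.sum_play_mul_estimate s hE]
  have hplay := hP.sum_play_mul_le s ℓ hℓ
  have hsq := hP.sum_play_mul_estimate_sq_le s hE ℓ hℓ
  have hout : ∑ w, (P.root s w.1 * P.exploit s w) *
      ∑ a, P.play s a * P.estimate E s (feedbackOf E ℓ a) w ^ 2 ≤
        4 * √(Fintype.card K : ℝ) / P.explore := by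
    have h : ∀ w ∈ Finset.univ, (P.root s w.1 * P.exploit s w) *
        ∑ a, P.play s a * P.estimate E s (feedbackOf E ℓ a) w ^ 2 ≤
          P.root s w.1 * P.inner s w.1 w.2 * (4 / P.explore) := by
      intro w _
      have hr := P.root_pos s w.1
      have hw := hP.weight_pos w.1
      have hx := P.inner_nonneg s w.1 w.2
      refine (mul_le_mul_of_nonneg_left (hsq w)
        (mul_nonneg hr.le (P.exploit_nonneg s w))).trans ?_
      have : P.root s w.1 ^ 2 * (4 / (P.explore * (P.weight w.1 + P.root s w.1 ^ 2))) ≤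
          4 / P.explore := by
        rw [mul_div_assoc', div_le_div_iff₀ (by positivity) hγ]
        nlinarith [mul_pos hγ hw]
      have := mul_le_mul_of_nonneg_left this (mul_nonneg hr.le hx)
      unfold exploit
      linarith
    refine (Finset.sum_le_sum h).trans ?_
    rw [← Finset.sum_mul, Fintype.sum_sigma]
    simp only [← Finset.mul_sum, sum_inner, mul_one]
    have := mul_le_mul_of_nonneg_right (sum_tsallisRoot_le fun k => P.outerRate * s.2 k)
      (show 0 ≤ 4 / P.explore by positivity)
    refine this.trans (le_of_eq ?_)
    ring
  have hin : P.innerRate v.1 * ∑ i, P.inner s v.1 i *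
      ∑ a, P.play s a * P.estimate E s (feedbackOf E ℓ a) ⟨v.1, i⟩ ^ 2 ≤
        4 * ρ / P.explore := by
    have hr := P.root_pos s v.1
    have hw := hP.weight_pos v.1
    have hε := hP.innerRate_pos v.1
    have h : ∀ i ∈ Finset.univ, P.inner s v.1 i *
      ∑ a, P.play s a * P.estimate E s (feedbackOf E ℓ a) ⟨v.1, i⟩ ^ 2 ≤
        P.inner s v.1 i * (4 / (P.explore * P.weight v.1)) := by
      intro i _
      refine mul_le_mul_of_nonneg_left ((hsq ⟨v.1, i⟩).trans ?_) (P.inner_nonneg s _ _)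
      gcongr
      nlinarith
    refine (mul_le_mul_of_nonneg_left (Finset.sum_le_sum h) hε.le).trans ?_
    rw [← Finset.sum_mul, sum_inner, one_mul, mul_div_assoc', div_le_div_iff₀ (by positivity) hγ]
    nlinarith [mul_le_mul_of_nonneg_left (hρ v.1) hγ.le]
  have hout' := mul_le_mul_of_nonneg_left hout hη.le
  have e : P.outerRate * (4 * √(Fintype.card K : ℝ) / P.explore) =
    4 * P.outerRate * √(Fintype.card K : ℝ) / P.explore := by ring
  rw [e] at hout'
  linarith

/-- Regret bound for the two-level algorithm. -/
theorem Valid.minimaxRegret_le [∀ k, Nonempty (I k)] (hP : P.Valid) (hE : P.WellObserved E) (ρ δ : ℝ)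
    (hρ : ∀ k, P.innerRate k ≤ ρ * P.weight k)
    (hδ : ∀ k, Real.log (Fintype.card (I k)) ≤ δ * P.innerRate k) (hρ₀ : 0 ≤ ρ) (hδ₀ : 0 ≤ δ)
    (T : ℕ) :
    minimaxRegret (Σ k, I k) E T ≤ 2 * √(Fintype.card K : ℝ) / P.outerRate + δ +
      T * (P.explore + 4 * P.outerRate * √(Fintype.card K : ℝ) / P.explore +
        4 * ρ / P.explore) := by
  have hγ := hP.explore_pos
  have hη := hP.outerRate_pos
  have : Nonempty (Σ k, I k) := ⟨⟨Classical.arbitrary K, Classical.arbitrary _⟩⟩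
  have hμ : ∀ s : BlockState K I, ∃ μ : PMF (Σ k, I k), ∀ a, (μ a).toReal = P.play s a := by
    intro s
    refine ⟨PMF.ofFintype (fun a => ENNReal.ofReal (P.play s a)) ?_, fun a => ?_⟩
    · rw [← ENNReal.ofReal_sum_of_nonneg fun a _ => hP.play_nonneg s a, hP.sum_play,
        ENNReal.ofReal_one]
    · rw [PMF.ofFintype_apply, ENNReal.toReal_ofReal (hP.play_nonneg s a)]
  choose μ hμ using hμ
  refine minimaxRegret_le_of_policy E T (fun h => μ (P.state E h)) _ (by positivity)
    fun ℓ hℓ => ?_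
  refine regret_le_of_potential _ E ℓ (fun v as => P.potential (P.state E (hist E ℓ as)) v)
    (P.explore + 4 * P.outerRate * √(Fintype.card K : ℝ) / P.explore + 4 * ρ / P.explore) _ T
    (fun v as => hP.potential_nonneg _ v) (fun v as => ?_) fun v => ?_
  · simp only [hμ, hist_append_singleton]
    have e : ∀ a, P.state E (hist E ℓ as ++ [(a, feedbackOf E (ℓ as.length) a)]) =
        P.next (P.state E (hist E ℓ as))
          (P.estimate E (P.state E (hist E ℓ as)) (feedbackOf E (ℓ as.length) a)) := fun a => by
      simp only [state, List.foldl_append, List.foldl_cons, List.foldl_nil]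
    simp only [e]
    exact hP.sum_play_mul_potential_le _ hE _ (hℓ _) ρ hρ v
  · refine add_le_add_left ((hP.potential_zero_le v).trans (add_le_add_right ?_ _)) _
    rw [div_le_iff₀ (hP.innerRate_pos _)]
    exact hδ v.1

end BlockParams

lemma BlockParams.Valid.wellObserved_looplessCliques {m : ℕ} [Nonempty (Fin m)] {n : Fin m → ℕ}
    (hn : ∀ k, 2 ≤ n k) {P : BlockParams (Fin m)} (hP : P.Valid) :
    P.WellObserved
      (fun a b : Σ k : Fin m, Fin (n k) => decide (a.1 = b.1 ∧ a ≠ b)) := by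
  rintro s ⟨k, i⟩
  have hγ := hP.explore_pos
  have hw := hP.weight_pos k
  have hn' : (2 : ℝ) ≤ n k := by exact_mod_cast hn k
  set x := P.explore * ((P.weight k + P.root s k ^ 2) / 2 / n k) with hx
  have hx0 : 0 ≤ x := by positivity
  have h₁ : P.explore * (P.weight k + P.root s k ^ 2) / 4 ≤ (n k - 1) * x := by
    have e : (n k - 1) * x - P.explore * (P.weight k + P.root s k ^ 2) / 4 =
        P.explore * (P.weight k + P.root s k ^ 2) * (n k - 2) / (4 * n k) := by
      rw [hx]
      field_simp
      ring
    have : 0 ≤ P.explore * (P.weight k + P.root s k ^ 2) * (n k - 2) / (4 * n k) := by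
      have : (0 : ℝ) ≤ n k - 2 := by linarith
      positivity
    linarith
  refine h₁.trans ?_
  unfold BlockParams.observe
  rw [Fintype.sum_sigma]
  refine le_trans ?_ (Finset.single_le_sum (fun k' _ => Finset.sum_nonneg fun j _ => ?_)
    (Finset.mem_univ k))
  · have h₂ : ∀ j ∈ Finset.univ.erase i, x ≤ if (decide ((⟨k, j⟩ : Σ k, Fin (n k)).1 = k ∧
        (⟨k, j⟩ : Σ k, Fin (n k)) ≠ ⟨k, i⟩)) = true then P.play s ⟨k, j⟩ else 0 := by
      intro j hj
      rw [if_pos (by simpa using Finset.ne_of_mem_erase hj)]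
      have := hP.explore_mul_le_play s ⟨k, j⟩
      rwa [Fintype.card_fin] at this
    have h₃ := Finset.card_nsmul_le_sum _ _ _ h₂
    rw [Finset.card_erase_of_mem (Finset.mem_univ i), Finset.card_univ, Fintype.card_fin,
      nsmul_eq_mul, Nat.cast_sub (by linarith [hn k]), Nat.cast_one] at h₃
    refine h₃.trans (Finset.sum_le_sum_of_subset_of_nonneg (Finset.erase_subset _ _)
      fun j _ _ => ?_)
    split_ifs
    · exact hP.play_nonneg s _
    · exact le_rfl
  · split_ifs
    · exact hP.play_nonneg s _
    · exact le_rfl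

/-- There is a universal constant `c > 0` such that for every disjoint
union of `m ≥ 2` loop-less cliques of sizes `n k ≥ 2`, the mini-max regret is at most
`c · (Σ_k log n_k)^{1/3} · T^{2/3}` for all sufficiently large `T`. -/
theorem union_of_loopless_cliques_minimax_regret :
    ∃ c : ℝ, 0 < c ∧
      ∀ (m : ℕ), 2 ≤ m → ∀ n : Fin m → ℕ, (∀ k, 2 ≤ n k) →
        ∃ T₀ : ℕ, ∀ T : ℕ, T₀ ≤ T →
          minimaxRegret (Σ k : Fin m, Fin (n k))
              (fun a b => decide (a.1 = b.1 ∧ a ≠ b)) T ≤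
            c * (∑ k : Fin m, Real.log (n k)) ^ ((1 : ℝ) / 3) * (T : ℝ) ^ ((2 : ℝ) / 3) := by
  refine ⟨16, by norm_num, fun m hm n hn => ?_⟩
  have hlog : ∀ k, (1 : ℝ) / 2 ≤ Real.log (n k) := fun k => by
    have h₁ : Real.log 2 ≤ Real.log (n k) :=
      Real.log_le_log (by norm_num) (by exact_mod_cast hn k)
    linarith [Real.log_two_gt_d9]
  set L := ∑ k : Fin m, Real.log (n k) with hL
  have hmL : (m : ℝ) ≤ 2 * L := by
    have := Finset.card_nsmul_le_sum Finset.univ _ _ fun k _ => hlog k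
    rw [Finset.card_univ, Fintype.card_fin, nsmul_eq_mul] at this
    linarith
  have hm' : (2 : ℝ) ≤ m := by exact_mod_cast hm
  have hL0 : 0 < L := by linarith
  refine ⟨⌈L⌉₊, fun T hT => ?_⟩
  have hLT : L ≤ T := (Nat.le_ceil L).trans (by exact_mod_cast hT)
  have hT0 : (0 : ℝ) < T := hL0.trans_le hLT
  set x := L ^ ((1 : ℝ) / 3) with hx
  set y := (T : ℝ) ^ ((1 : ℝ) / 3) with hy
  have hx0 : 0 < x := Real.rpow_pos_of_pos hL0 _
  have hy0 : 0 < y := Real.rpow_pos_of_pos hT0 _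
  have hxy : x ≤ y := Real.rpow_le_rpow hL0.le hLT (by norm_num)
  have hx3 : L = x ^ 3 := by
    rw [hx, ← Real.rpow_natCast, ← Real.rpow_mul hL0.le]
    norm_num
  have hy3 : (T : ℝ) = y ^ 3 := by
    rw [hy, ← Real.rpow_natCast, ← Real.rpow_mul hT0.le]
    norm_num
  have hy2 : (T : ℝ) ^ ((2 : ℝ) / 3) = y ^ 2 := by
    rw [hy, ← Real.rpow_natCast, ← Real.rpow_mul hT0.le]
    norm_num
  have hs0 : 0 < √(m : ℝ) := Real.sqrt_pos.2 (by linarith)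
  have hss : √(m : ℝ) * √(m : ℝ) = m := Real.mul_self_sqrt (by linarith)
  have : Nonempty (Fin m) := ⟨⟨0, by omega⟩⟩
  have : ∀ k, Nonempty (Fin (n k)) := fun k => ⟨⟨0, by have := hn k; omega⟩⟩
  let P : BlockParams (Fin m) :=
    { explore := x / y
      outerRate := √(m : ℝ) / (x * y ^ 2)
      innerRate := fun k => Real.log (n k) / (x * y ^ 2)
      weight := fun k => Real.log (n k) / L }
  have hP : P.Valid :=
    { explore_pos := div_pos hx0 hy0
      explore_le_one := (div_le_one hy0).2 hxy
      outerRate_pos := by positivity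
      innerRate_pos := fun k => div_pos (by linarith [hlog k]) (by positivity)
      weight_pos := fun k => div_pos (by linarith [hlog k]) hL0
      sum_weight := by
        change ∑ k, Real.log (n k) / L = 1
        rw [← Finset.sum_div, div_self hL0.ne'] }
  refine (hP.minimaxRegret_le (hP.wellObserved_looplessCliques hn) (L / (x * y ^ 2)) (x * y ^ 2)
    (fun k => le_of_eq ?_) (fun k => le_of_eq ?_) (by positivity) (by positivity) T).trans ?_
  · change Real.log (n k) / (x * y ^ 2) = L / (x * y ^ 2) * (Real.log (n k) / L)
    field_simp
  · change Real.log (Fintype.card (Fin (n k))) = x * y ^ 2 * (Real.log (n k) / (x * y ^ 2))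
    rw [Fintype.card_fin]
    field_simp
  · change 2 * √(Fintype.card (Fin m) : ℝ) / (√(m : ℝ) / (x * y ^ 2)) + x * y ^ 2 +
      T * (x / y + 4 * (√(m : ℝ) / (x * y ^ 2)) * √(Fintype.card (Fin m) : ℝ) / (x / y) +
        4 * (L / (x * y ^ 2)) / (x / y)) ≤ _
    rw [Fintype.card_fin, hy2, hy3]
    have e₁ : 2 * √(m : ℝ) / (√(m : ℝ) / (x * y ^ 2)) = 2 * (x * y ^ 2) := by
      field_simp
    have e₂ : 4 * (√(m : ℝ) / (x * y ^ 2)) * √(m : ℝ) / (x / y) =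
        4 * (√(m : ℝ) * √(m : ℝ)) / (x ^ 2 * y) := by
      generalize √(m : ℝ) = r
      field_simp
    rw [hss] at e₂
    have e₃ : 4 * (L / (x * y ^ 2)) / (x / y) = 4 * L / (x ^ 2 * y) := by
      field_simp
    have e₄ : y ^ 3 * (x / y + 8 * L / (x ^ 2 * y) + 4 * L / (x ^ 2 * y)) = 13 * (x * y ^ 2) := by
      rw [hx3]
      field_simp
      ring
    have h₁ : 4 * (m : ℝ) / (x ^ 2 * y) ≤ 8 * L / (x ^ 2 * y) := by
      exact div_le_div_of_nonneg_right (by linarith) (by positivity)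
    have h₂ := mul_le_mul_of_nonneg_left h₁ (pow_pos hy0 3).le
    rw [e₁, e₂, e₃]
    linarith
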